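/- arXiv:2503.24126 — 5 statements merged into one kernel-verified Lean document; each statement's English description precedes it below -/
import Mathlib

section
/- Let (X,d) be a complete, locally compact metric space and let {x^k}_{k∈ℕ} be a sequence in X that is quasi-Fejér with respect to a nonempty set U ⊆ X. Then {x^k} is bounded. Moreover, if some cluster point x* of {x^k} belongs to U, then the whole sequence converges: lim_{k→∞} x^k = x*. -/
open Filter

/-- A real sequence whose increments are bounded above by a summable nonnegative sequence
exceeds any of its earlier terms by at most the corresponding tail sum. -/
theorem le_add_tsum_nat_add_of_le_add {a ε : ℕ → ℝ} (hε : ∀ k, 0 ≤ ε k) (hs : Summable ε)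
    (ha : ∀ k, a (k + 1) ≤ a k + ε k) {m n : ℕ} (hmn : m ≤ n) :
    a n ≤ a m + ∑' i, ε (i + m) := by
  have partial_sum (j : ℕ) : a (j + m) ≤ a m + ∑ i ∈ Finset.range j, ε (i + m) := by
    induction j with
    | zero => simp
    | succ j ih =>
      rw [Finset.sum_range_succ, Nat.add_right_comm]
      linarith [ha (j + m)]
  obtain ⟨j, rfl⟩ := Nat.exists_eq_add_of_le' hmn
  grw [partial_sum j,
    ((summable_nat_add_iff m).2 hs).sum_le_tsum (Finset.range j) fun i _ => hε (i + m)]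

/-- A nonnegative real sequence whose increments are bounded above by a summable nonnegative
sequence tends to zero as soon as it is frequently arbitrarily small. -/
theorem tendsto_zero_of_le_add_of_frequently_lt {a ε : ℕ → ℝ} (ha₀ : ∀ k, 0 ≤ a k)
    (hε : ∀ k, 0 ≤ ε k) (hs : Summable ε) (ha : ∀ k, a (k + 1) ≤ a k + ε k)
    (hfreq : ∀ δ > 0, ∃ᶠ k in atTop, a k < δ) : Tendsto a atTop (nhds 0) := by
  refine tendsto_order.2 ⟨fun b hb => .of_forall fun k => hb.trans_le (ha₀ k), fun b hb => ?_⟩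
  have tail_lt : ∀ᶠ m in atTop, ∑' i, ε (i + m) < b / 2 :=
    (tendsto_sum_nat_add ε).eventually_lt_const (half_pos hb)
  obtain ⟨m, hm, hmb⟩ := ((hfreq (b / 2) (half_pos hb)).and_eventually tail_lt).exists
  filter_upwards [eventually_ge_atTop m] with n hn
  linarith [le_add_tsum_nat_add_of_le_add hε hs ha hn]

/-- In a complete locally compact metric space, a quasi-Fejér sequence
with respect to a nonempty set `U` is bounded, and if one of its cluster points belongs
to `U`, the whole sequence converges to it. -/
theorem quasiFejer_bounded_and_convergent
    {X : Type*} [MetricSpace X] [CompleteSpace X] [LocallyCompactSpace X]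
    (x : ℕ → X) (U : Set X) (hU : U.Nonempty)
    (hqf : ∀ xb ∈ U, ∃ ε : ℕ → ℝ, (∀ k, 0 ≤ ε k) ∧ Summable ε ∧
      ∀ k, dist (x (k + 1)) xb ^ 2 ≤ dist (x k) xb ^ 2 + ε k) :
    Bornology.IsBounded (Set.range x) ∧
      ∀ xs ∈ U, MapClusterPt xs atTop x → Tendsto x atTop (nhds xs) := by
  refine ⟨?_, fun xs hxs hcl => ?_⟩
  · obtain ⟨xb, hxb⟩ := hU
    obtain ⟨ε, hε, hs, hd⟩ := hqf xb hxb
    refine (Metric.isBounded_iff_subset_closedBall xb).2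
      ⟨√(dist (x 0) xb ^ 2 + ∑' i, ε (i + 0)), Set.range_subset_iff.2 fun k => ?_⟩
    exact Metric.mem_closedBall.2 (Real.le_sqrt_of_sq_le
      (le_add_tsum_nat_add_of_le_add (a := fun k => dist (x k) xb ^ 2) hε hs hd k.zero_le))
  · obtain ⟨ε, hε, hs, hd⟩ := hqf xs hxs
    have sq_tendsto : Tendsto (fun k => dist (x k) xs ^ 2) atTop (nhds 0) := by
      refine tendsto_zero_of_le_add_of_frequently_lt (fun k => sq_nonneg _) hε hs hd
        fun δ hδ => ?_
      refine (hcl.frequently (Metric.ball_mem_nhds xs (Real.sqrt_pos.2 hδ))).mono fun k hk => ?_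
      exact (Real.lt_sqrt dist_nonneg).1 (Metric.mem_ball.1 hk)
    exact tendsto_iff_dist_tendsto_zero.2 (by simpa [Real.sqrt_sq] using sq_tendsto.sqrt)
end

section
/- Let (X,d) be a proper metric space (closed bounded sets are compact; this holds in particular for complete locally compact geodesic spaces), let G : X → ℝ ∪ {∞} be proper and lower semicontinuous, and suppose the set U* of global minimisers of G is nonempty. Let {τ_k}_{k∈ℕ} be positive reals with ∑_{k=0}^∞ τ_k = ∞, and let {x^k}_{k∈ℕ} ⊆ X satisfy, for every k ∈ ℕ and every y ∈ X with G(y) < ∞, the proximal-step inequality G(x^{k+1}) + (1/(2τ_k)) d²(y, x^{k+1}) ≤ G(y) + (1/(2τ_k)) d²(y, x^k). Then {x^k} converges to some point x* ∈ U*. -/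
open Filter

/-- If `a` is antitone and nonnegative and the sums of `τ k * a k` are controlled by a telescoping
nonnegative sequence, where `τ` is positive with divergent sum, then `a` tends to zero. -/
theorem tendsto_zero_of_antitone_of_mul_le_sub {τ a b : ℕ → ℝ} (hτ : ∀ k, 0 < τ k)
    (hτsum : ¬ Summable τ) (ha : Antitone a) (ha0 : ∀ k, 0 ≤ a k) (hb : ∀ k, 0 ≤ b k)
    (h : ∀ k, τ k * a k ≤ b k - b (k + 1)) : Tendsto a atTop (nhds 0) := by
  have hlim : Tendsto a atTop (nhds (⨅ k, a k)) :=
    tendsto_atTop_ciInf ha ⟨0, by rintro _ ⟨k, rfl⟩; exact ha0 k⟩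
  have hle : ∀ k, (⨅ k, a k) ≤ a k := ha.le_of_tendsto hlim
  rcases (le_ciInf ha0).eq_or_lt with h0 | hpos
  · rwa [← h0] at hlim
  · refine absurd (summable_of_sum_range_le (c := b 0 / ⨅ k, a k) (fun k => (hτ k).le) ?_) hτsum
    intro n
    rw [le_div_iff₀ hpos, Finset.sum_mul]
    calc ∑ k ∈ Finset.range n, τ k * (⨅ k, a k)
        ≤ ∑ k ∈ Finset.range n, (b k - b (k + 1)) := Finset.sum_le_sum fun k _ =>
          (mul_le_mul_of_nonneg_left (hle k) (hτ k).le).trans (h k)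
      _ = b 0 - b n := Finset.sum_range_sub' b n
      _ ≤ b 0 := sub_le_self _ (hb n)

/-- A sequence in a metric space whose distance to `p` is antitone and which has a subsequence
tending to `p` tends to `p`. -/
theorem tendsto_of_antitone_dist_of_subseq {X : Type*} [PseudoMetricSpace X] {x : ℕ → X} {p : X}
    (h : Antitone fun k => dist p (x k)) {φ : ℕ → ℕ} (hφ : Tendsto φ atTop atTop)
    (hx : Tendsto (x ∘ φ) atTop (nhds p)) : Tendsto x atTop (nhds p) := by
  rw [tendsto_iff_dist_tendsto_zero] at hx ⊢
  simp only [dist_comm _ p] at hx ⊢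
  exact (tendsto_iff_tendsto_subseq_of_antitone h hφ).2 hx

/-- In a proper metric space, a sequence satisfying the fundamental
proximal-step inequality with positive step sizes `τ_k`, `∑ τ_k = ∞`, for a proper lower
semicontinuous `G : X → ℝ ∪ {∞}` whose minimiser set is nonempty, converges to a global
minimiser of `G`. -/
theorem proximal_point_converges
    {X : Type*} [MetricSpace X] [ProperSpace X]
    (G : X → EReal) (hGbot : ∀ y, G y ≠ ⊥) (hGproper : ∃ p, G p ≠ ⊤)
    (hGlsc : LowerSemicontinuous G)
    (hUstar : {p : X | ∀ y, G p ≤ G y}.Nonempty)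
    (τ : ℕ → ℝ) (hτ : ∀ k, 0 < τ k) (hτsum : ¬ Summable τ)
    (x : ℕ → X)
    (hprox : ∀ k, ∀ y : X, G y ≠ ⊤ →
      G (x (k + 1)) + ((1 / (2 * τ k) * dist y (x (k + 1)) ^ 2 : ℝ) : EReal) ≤
        G y + ((1 / (2 * τ k) * dist y (x k) ^ 2 : ℝ) : EReal)) :
    ∃ xs : X, (∀ y, G xs ≤ G y) ∧ Tendsto x atTop (nhds xs) := by
  obtain ⟨p, hp⟩ := hUstar
  obtain ⟨q, hq⟩ := hGproper
  have hp_top : G p ≠ ⊤ := ((hp q).trans_lt hq.lt_top).ne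
  have hfin : ∀ k, G (x (k + 1)) ≠ ⊤ := by
    intro k hk
    have h := hprox k p hp_top
    rw [hk, EReal.top_add_coe, top_le_iff] at h
    exact (EReal.add_lt_top hp_top (EReal.coe_ne_top _)).ne h
  have hreal : ∀ k y, G y ≠ ⊤ → τ k * ((G (x (k + 1))).toReal - (G y).toReal) ≤
      dist y (x k) ^ 2 / 2 - dist y (x (k + 1)) ^ 2 / 2 := by
    intro k y hy
    have h := hprox k y hy
    rw [← EReal.coe_toReal (hfin k) (hGbot _), ← EReal.coe_toReal hy (hGbot y)] at h
    have h' : (G (x (k + 1))).toReal + 1 / (2 * τ k) * dist y (x (k + 1)) ^ 2 ≤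
        (G y).toReal + 1 / (2 * τ k) * dist y (x k) ^ 2 := by exact_mod_cast h
    have hmul := mul_le_mul_of_nonneg_left h' (hτ k).le
    have hcancel : ∀ d : ℝ, τ k * (1 / (2 * τ k) * d) = d / 2 := by
      intro d
      have := (hτ k).ne'
      field_simp
    rw [mul_add, mul_add, hcancel, hcancel] at hmul
    linarith
  have hfejer : ∀ z, (∀ y, G z ≤ G y) → Antitone fun k => dist z (x k) := by
    intro z hz
    refine antitone_nat_of_succ_le fun k => ?_
    have hz_top : G z ≠ ⊤ := ((hz p).trans_lt hp_top.lt_top).ne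
    have hval := EReal.toReal_le_toReal (hz (x (k + 1))) (hGbot z) (hfin k)
    have hstep := hreal k z hz_top
    have hnonneg := mul_nonneg (hτ k).le (sub_nonneg.2 hval)
    exact le_of_sq_le_sq (by linarith) dist_nonneg
  have hanti : Antitone fun k => (G (x (k + 1))).toReal - (G p).toReal := by
    refine antitone_nat_of_succ_le fun k => ?_
    have h := hreal (k + 1) (x (k + 1)) (hfin k)
    rw [dist_self] at h
    have hneg : τ (k + 1) * ((G (x (k + 1 + 1))).toReal - (G (x (k + 1))).toReal) ≤ 0 := by
      nlinarith [sq_nonneg (dist (x (k + 1)) (x (k + 1 + 1)))]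
    have := nonpos_of_mul_nonpos_right hneg (hτ (k + 1))
    linarith
  have hzero := tendsto_zero_of_antitone_of_mul_le_sub (b := fun k => dist p (x k) ^ 2 / 2)
    hτ hτsum hanti
    (fun k => sub_nonneg.2 (EReal.toReal_le_toReal (hp _) (hGbot p) (hfin k)))
    (fun k => by positivity) (fun k => hreal k p hp_top)
  have hG : Tendsto (fun k => G (x (k + 1))) atTop (nhds (G p)) := by
    have h : Tendsto (fun k => (G (x (k + 1))).toReal) atTop (nhds (G p).toReal) := by
      simpa using hzero.add_const (G p).toReal
    simpa only [EReal.coe_toReal (hfin _) (hGbot _), EReal.coe_toReal hp_top (hGbot p)]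
      using EReal.tendsto_coe.2 h
  obtain ⟨z, -, φ, hφ, hz⟩ := (isCompact_closedBall p (dist p (x 0))).tendsto_subseq
    (x := fun k => x (k + 1)) fun k => by
      rw [Metric.mem_closedBall, dist_comm]
      exact hfejer p hp (Nat.zero_le _)
  have hz_le : G z ≤ G p := le_of_forall_lt fun c hc => by
    obtain ⟨c', hcc', hc'⟩ := exists_between hc
    exact hcc'.trans_le (ge_of_tendsto (hG.comp hφ.tendsto_atTop)
      ((hz.eventually (hGlsc z c' hc')).mono fun _ h => h.le))
  have hz_min : ∀ y, G z ≤ G y := fun y => hz_le.trans (hp y)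
  exact ⟨z, hz_min, tendsto_of_antitone_dist_of_subseq (hfejer z hz_min)
    ((tendsto_add_atTop_nat 1).comp hφ.tendsto_atTop) hz⟩
end

section
/- Let (X,d) be a metric space, G : X → ℝ ∪ {∞} proper, and let x* be a global minimiser of G. Let τ > 0 and let {τ_k}_{k∈ℕ} satisfy τ_k ≥ τ for all k. Suppose the sequence {x^k}_{k∈ℕ} ⊆ X satisfies, for every k ∈ ℕ and every y ∈ X with G(y) < ∞, the inequality G(x^{k+1}) + (1/(2τ_k)) d²(y, x^{k+1}) ≤ G(y) + (1/(2τ_k)) d²(y, x^k). Then for every N ∈ ℕ one has G(x^{N+1}) − G(x*) ≤ d²(x*, x⁰) / (2τ(N+1)). -/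
/-- A real antitone sequence `g` bounded below by `m` whose gaps `g k - m` are controlled by the
decrements of a sequence `D` satisfies a telescoped estimate with rate `1 / (N + 1)`. -/
theorem Antitone.mul_sub_le_of_decrement {g D : ℕ → ℝ} {m c : ℝ} (hc : 0 ≤ c)
    (hg : Antitone g) (hstep : ∀ k, c * (g k - m) ≤ D k - D (k + 1)) (N : ℕ) :
    c * (N + 1) * (g N - m) ≤ D 0 - D (N + 1) := by
  induction N with
  | zero => simpa using hstep 0
  | succ N ih =>
    have hmono : c * (N + 1) * (g (N + 1) - m) ≤ c * (N + 1) * (g N - m) := by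
      gcongr
      exact hg N.le_succ
    push_cast
    linarith [hstep (N + 1)]

/-- Iteration-complexity bound for the proximal point iteration: under the
fundamental proximal-step inequality with step sizes `τ_k ≥ τ > 0`, for a global minimiser
`x*` of a proper `G : X → ℝ ∪ {∞}` we have
`G(x^{N+1}) − G(x*) ≤ d²(x*, x⁰) / (2τ(N+1))`. -/
theorem proximal_point_iteration_complexity
    {X : Type*} [MetricSpace X]
    (G : X → EReal) (hGbot : ∀ y, G y ≠ ⊥) (hGproper : ∃ p, G p ≠ ⊤)
    (xstar : X) (hmin : ∀ y, G xstar ≤ G y)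
    (τ : ℝ) (hτ : 0 < τ) (τs : ℕ → ℝ) (hτs : ∀ k, τ ≤ τs k)
    (x : ℕ → X)
    (hprox : ∀ k, ∀ y : X, G y ≠ ⊤ →
      G (x (k + 1)) + ((1 / (2 * τs k) * dist y (x (k + 1)) ^ 2 : ℝ) : EReal) ≤
        G y + ((1 / (2 * τs k) * dist y (x k) ^ 2 : ℝ) : EReal)) :
    ∀ N : ℕ,
      G (x (N + 1)) - G xstar ≤ ((dist xstar (x 0) ^ 2 / (2 * τ * (N + 1)) : ℝ) : EReal) := by
  intro N
  have hstar : G xstar ≠ ⊤ := by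
    obtain ⟨p, hp⟩ := hGproper
    exact ne_top_of_le_ne_top hp (hmin p)
  have hfin : ∀ k, G (x (k + 1)) ≠ ⊤ := by
    intro k hk
    have h := hprox k xstar hstar
    rw [hk, EReal.top_add_coe, top_le_iff] at h
    exact EReal.add_ne_top hstar (EReal.coe_ne_top _) h
  have hcoe : ∀ {y}, G y ≠ ⊤ → ((G y).toReal : EReal) = G y :=
    fun {y} hy => EReal.coe_toReal hy (hGbot y)
  have hreal : ∀ k y, G y ≠ ⊤ →
      (G (x (k + 1))).toReal + 1 / (2 * τs k) * dist y (x (k + 1)) ^ 2 ≤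
        (G y).toReal + 1 / (2 * τs k) * dist y (x k) ^ 2 := by
    intro k y hy
    have h := hprox k y hy
    rw [← hcoe hy, ← hcoe (hfin k)] at h
    exact_mod_cast h
  have hpos : ∀ k, 0 < τs k := fun k => hτ.trans_le (hτs k)
  have hanti : Antitone fun k => (G (x (k + 1))).toReal := by
    refine antitone_nat_of_succ_le fun k => ?_
    have h := hreal (k + 1) (x (k + 1)) (hfin k)
    have := hpos (k + 1)
    have hnonneg : 0 ≤ 1 / (2 * τs (k + 1)) * dist (x (k + 1)) (x (k + 1 + 1)) ^ 2 := by
      positivity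
    rw [dist_self] at h
    linarith
  have hstep : ∀ k, 2 * τ * ((G (x (k + 1))).toReal - (G xstar).toReal) ≤
      dist xstar (x k) ^ 2 - dist xstar (x (k + 1)) ^ 2 := by
    intro k
    have hgap : (G xstar).toReal ≤ (G (x (k + 1))).toReal :=
      EReal.toReal_le_toReal (hmin _) (hGbot _) (hfin k)
    have h := hreal k xstar hstar
    have := hpos k
    calc 2 * τ * ((G (x (k + 1))).toReal - (G xstar).toReal)
        ≤ 2 * τs k * ((G (x (k + 1))).toReal - (G xstar).toReal) := by
          have := sub_nonneg.2 hgap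
          gcongr
          exact hτs k
      _ ≤ 2 * τs k * (1 / (2 * τs k) * (dist xstar (x k) ^ 2 - dist xstar (x (k + 1)) ^ 2)) := by
          gcongr
          linarith
      _ = dist xstar (x k) ^ 2 - dist xstar (x (k + 1)) ^ 2 := by
          field_simp
  have hsum := hanti.mul_sub_le_of_decrement (D := fun k => dist xstar (x k) ^ 2)
    (by positivity) hstep N
  rw [← hcoe (hfin N), ← hcoe hstar, ← EReal.coe_sub, EReal.coe_le_coe_iff,
    le_div_iff₀ (by positivity)]
  have := sq_nonneg (dist xstar (x (N + 1)))
  linarith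
end

section
/- Let (X,d) be a metric space, G : X → ℝ ∪ {∞}, and F : X → ℝ Lipschitz continuous with constant L_F > 0, such that H := G + F is proper and attains a global minimum at x* ∈ X. Let r > 0, R > 2r, L_exp ≥ 0, and τ > 0 with τ ≤ (R − 2r)/(2 L_F (1 + L_exp)). Suppose x ∈ X satisfies d(x, x*) ≤ r, suppose w ∈ X satisfies d(x, w) ≤ L_F L_exp τ, and suppose x⁺ ∈ X minimises y ↦ G(y) + (1/(2τ)) d²(y, w) over X. Then d(x*, w) ≤ R/2 ≤ R and d(x*, x⁺) ≤ R; that is, both w and x⁺ lie in the closed ball of radius R around x*. -/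
/-- A priori locality for the forward-backward method: if
`d(x, x*) ≤ r`, the gradient step moves by at most `L_F L_exp τ`, the proximal step `x⁺`
minimises `y ↦ G(y) + d²(y,w)/(2τ)`, and `τ ≤ (R − 2r)/(2 L_F (1 + L_exp))` with `R > 2r`,
then both `w` and `x⁺` stay in the closed ball of radius `R` around the minimiser `x*`. -/
theorem forward_backward_a_priori_locality
    {X : Type*} [MetricSpace X]
    (G : X → EReal) (hGbot : ∀ y, G y ≠ ⊥)
    (F : X → ℝ) (L_F : ℝ) (hLF : 0 < L_F)
    (hlip : ∀ p q : X, |F p - F q| ≤ L_F * dist p q)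
    (hproper : ∃ p, G p + (F p : EReal) ≠ ⊤)
    (xstar : X) (hmin : ∀ y, G xstar + (F xstar : EReal) ≤ G y + (F y : EReal))
    (r R L_exp τ : ℝ) (hr : 0 < r) (hR : 2 * r < R) (hLexp : 0 ≤ L_exp)
    (hτpos : 0 < τ) (hτ : τ ≤ (R - 2 * r) / (2 * L_F * (1 + L_exp)))
    (x w xplus : X)
    (hx : dist x xstar ≤ r)
    (hw : dist x w ≤ L_F * L_exp * τ)
    (hprox : ∀ y : X,
      G xplus + ((1 / (2 * τ) * dist xplus w ^ 2 : ℝ) : EReal) ≤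
        G y + ((1 / (2 * τ) * dist y w ^ 2 : ℝ) : EReal)) :
    dist xstar w ≤ R / 2 ∧ R / 2 ≤ R ∧ dist xstar xplus ≤ R := by
  have hGstar : G xstar ≠ ⊤ := by
    intro h
    obtain ⟨p, hp⟩ := hproper
    have hle := hmin p
    rw [h, EReal.top_add_coe] at hle
    exact hp (top_le_iff.mp hle)
  have hle_min := hmin xplus
  have hle_prox := hprox xstar
  have hGplus : G xplus ≠ ⊤ := by
    intro h
    rw [h, EReal.top_add_coe, top_le_iff] at hle_prox
    exact EReal.add_ne_top hGstar (EReal.coe_ne_top _) hle_prox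
  lift G xstar to ℝ using ⟨hGstar, hGbot xstar⟩ with gstar
  lift G xplus to ℝ using ⟨hGplus, hGbot xplus⟩ with gplus
  norm_cast at hle_min hle_prox
  have hden : 0 < 2 * L_F * (1 + L_exp) := by positivity
  rw [le_div_iff₀ hden] at hτ
  have hLτ : 0 < L_F * τ := mul_pos hLF hτpos
  have hstar_w : dist xstar w ≤ R / 2 - L_F * τ := by
    have htri := dist_triangle xstar x w
    rw [dist_comm xstar x] at htri
    linarith
  have htri : dist xstar xplus ≤ dist xstar w + dist xplus w := dist_triangle_right _ _ _
  have hF : F xplus - F xstar ≤ L_F * dist xstar xplus := by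
    rw [dist_comm xstar xplus]
    exact (le_abs_self _).trans (hlip xplus xstar)
  have hsq : dist xplus w ^ 2 - dist xstar w ^ 2 ≤
      2 * τ * (L_F * (dist xstar w + dist xplus w)) := by
    have hdiff : (dist xplus w ^ 2 - dist xstar w ^ 2) / (2 * τ) ≤
        L_F * (dist xstar w + dist xplus w) := by
      have hmul := mul_le_mul_of_nonneg_left htri hLF.le
      have hsplit : (dist xplus w ^ 2 - dist xstar w ^ 2) / (2 * τ) =
          1 / (2 * τ) * dist xplus w ^ 2 - 1 / (2 * τ) * dist xstar w ^ 2 := by ring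
      linarith
    rwa [div_le_iff₀' (by positivity)] at hdiff
  have hplus_w : dist xplus w ≤ dist xstar w + 2 * (L_F * τ) := by
    by_contra! hlt
    have hstar_nonneg : 0 ≤ dist xstar w := dist_nonneg
    have hsum : 0 < dist xstar w + dist xplus w := by linarith
    nlinarith [mul_pos hsum (sub_pos.mpr hlt)]
  exact ⟨by linarith, by linarith, by linarith⟩
end

section
/- Let (X,d) be a proper metric space (closed bounded sets are compact; this holds in particular for complete locally compact geodesic spaces), let H : X → ℝ ∪ {∞} be proper and lower semicontinuous, and suppose the set U* of global minimisers of H is nonempty. Let {τ_k}_{k∈ℕ} be positive reals with ∑_{k=0}^∞ τ_k = ∞ and let {c_k}_{k∈ℕ} be nonnegative reals with ∑_{k=0}^∞ c_k < ∞. Suppose the sequence {x^k}_{k∈ℕ} ⊆ X satisfies, for every k ∈ ℕ and every y ∈ U*, the inequality 2τ_k (H(x^{k+1}) − H(y)) ≤ d²(y, x^k) − d²(y, x^{k+1}) + c_k. Then {x^k} converges to some global minimiser of H. -/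
open Filter

/-- A nonnegative real sequence that decreases up to a summable error converges. -/
theorem exists_tendsto_of_le_add_summable {u c : ℕ → ℝ} (hu : ∀ k, 0 ≤ u k) (hc : ∀ k, 0 ≤ c k)
    (hcsum : Summable c) (h : ∀ k, u (k + 1) ≤ u k + c k) : ∃ l, Tendsto u atTop (nhds l) := by
  have hanti : Antitone fun n => u n - ∑ i ∈ Finset.range n, c i :=
    antitone_nat_of_succ_le fun n => by
      simp only [Finset.sum_range_succ]
      linarith [h n]
  have hbdd : BddBelow (Set.range fun n => u n - ∑ i ∈ Finset.range n, c i) := by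
    refine ⟨-∑' i, c i, ?_⟩
    rintro _ ⟨n, rfl⟩
    have := hcsum.sum_le_tsum (Finset.range n) fun i _ => hc i
    dsimp only
    linarith [hu n]
  exact ⟨_, by simpa using
    (tendsto_atTop_ciInf hanti hbdd).add hcsum.hasSum.tendsto_sum_nat⟩

/-- If the weights `τ` are not summable but `τ * w` is, then `w` is frequently small. -/
theorem frequently_lt_of_summable_mul {τ w : ℕ → ℝ} (hτ : ∀ k, 0 < τ k) (hτsum : ¬ Summable τ)
    (hw : Summable fun k => τ k * w k) {ε : ℝ} (hε : 0 < ε) : ∃ᶠ k in atTop, w k < ε := by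
  intro hev
  refine hτsum (Summable.of_norm_bounded_eventually_nat (hw.mul_left ε⁻¹) ?_)
  filter_upwards [hev] with k hk
  rw [Real.norm_of_nonneg (hτ k).le, inv_mul_eq_div, le_div_iff₀ hε]
  exact mul_le_mul_of_nonneg_left (not_lt.mp hk) (hτ k).le

/-- Nonnegative terms dominated by a telescoping difference plus a summable error are summable. -/
theorem summable_of_le_sub_add {a u c : ℕ → ℝ} (ha : ∀ k, 0 ≤ a k) (hu : ∀ k, 0 ≤ u k)
    (hc : ∀ k, 0 ≤ c k) (hcsum : Summable c) (h : ∀ k, a k ≤ u k - u (k + 1) + c k) :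
    Summable a := by
  refine summable_of_sum_range_le (c := u 0 + ∑' i, c i) ha fun n => ?_
  have hsum := Finset.sum_le_sum fun k (_ : k ∈ Finset.range n) => h k
  rw [Finset.sum_add_distrib, Finset.sum_range_sub'] at hsum
  linarith [hu n, hcsum.sum_le_tsum (Finset.range n) fun i _ => hc i]

/-- A lower semicontinuous function is at most `m` at the limit of a sequence along which it is
bounded by reals tending to `m`. -/
theorem LowerSemicontinuous.le_of_tendsto_of_le_coe {X : Type*} [TopologicalSpace X] {H : X → EReal}
    (hH : LowerSemicontinuous H) {z : ℕ → X} {p : X} (hz : Tendsto z atTop (nhds p))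
    {b : ℕ → ℝ} {m : ℝ} (hb : Tendsto b atTop (nhds m)) (hle : ∀ n, H (z n) ≤ b n) : H p ≤ m := by
  by_contra! hlt
  obtain ⟨r, hmr, hrp⟩ := EReal.lt_iff_exists_real_btwn.mp hlt
  obtain ⟨n, hrn, hbn⟩ := ((hz.eventually (hH p r hrp)).and
    (hb.eventually_lt_const (EReal.coe_lt_coe_iff.mp hmr))).exists
  exact absurd (hrn.trans_le (hle n)) (not_lt.mpr (EReal.coe_le_coe_iff.mpr hbn.le))

/-- Convergence mechanism of the forward-backward method: in a proper metric
space, if a sequence satisfies the key estimate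
`2τ_k (H(x^{k+1}) − H(y)) ≤ d²(y,x^k) − d²(y,x^{k+1}) + c_k` for every global minimiser `y` of a
proper lsc `H : X → ℝ ∪ {∞}`, with positive `τ_k`, `∑ τ_k = ∞` and summable nonnegative `c_k`,
then the sequence converges to a global minimiser of `H`. -/
theorem forward_backward_converges
    {X : Type*} [MetricSpace X] [ProperSpace X]
    (H : X → EReal) (hHbot : ∀ y, H y ≠ ⊥) (hHproper : ∃ p, H p ≠ ⊤)
    (hHlsc : LowerSemicontinuous H)
    (hUstar : {p : X | ∀ y, H p ≤ H y}.Nonempty)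
    (τ : ℕ → ℝ) (hτ : ∀ k, 0 < τ k) (hτsum : ¬ Summable τ)
    (c : ℕ → ℝ) (hc : ∀ k, 0 ≤ c k) (hcsum : Summable c)
    (x : ℕ → X)
    (hkey : ∀ k, ∀ y : X, (∀ z, H y ≤ H z) →
      ((2 * τ k : ℝ) : EReal) * (H (x (k + 1)) - H y) ≤
        ((dist y (x k) ^ 2 - dist y (x (k + 1)) ^ 2 + c k : ℝ) : EReal)) :
    ∃ xs : X, (∀ y, H xs ≤ H y) ∧ Tendsto x atTop (nhds xs) := by
  obtain ⟨y₀, hy₀⟩ := hUstar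
  obtain ⟨p, hp⟩ := hHproper
  lift H y₀ to ℝ using ⟨fun h => hp (top_le_iff.mp (h ▸ hy₀ p)), hHbot y₀⟩ with m hm
  have hmin : ∀ y, (m : EReal) ≤ H y := fun y => hm ▸ hy₀ y
  have hval : ∀ y, (∀ z, H y ≤ H z) → H y = m := fun y hy => ((hy y₀).trans hm.ge).antisymm (hmin y)
  have hfin : ∀ k, H (x (k + 1)) ≠ ⊤ := by
    intro k htop
    have hk := hkey k y₀ hy₀
    rw [htop, ← hm, EReal.top_sub_coe,
      EReal.coe_mul_top_of_pos (mul_pos two_pos (hτ k))] at hk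
    exact EReal.coe_ne_top _ (top_le_iff.mp hk)
  obtain ⟨g, hg⟩ : ∃ g : ℕ → ℝ, ∀ k, H (x (k + 1)) = g k :=
    ⟨fun k => (H (x (k + 1))).toReal, fun k => (EReal.coe_toReal (hfin k) (hHbot _)).symm⟩
  have hgm : ∀ k, 0 ≤ g k - m := fun k =>
    sub_nonneg.mpr (EReal.coe_le_coe_iff.mp (hg k ▸ hmin (x (k + 1))))
  have hest : ∀ y, (∀ z, H y ≤ H z) → ∀ k,
      2 * τ k * (g k - m) ≤ dist y (x k) ^ 2 - dist y (x (k + 1)) ^ 2 + c k := by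
    intro y hy k
    have hk := hkey k y hy
    rw [hg, hval y hy] at hk
    exact_mod_cast hk
  have hprod : ∀ k, 0 ≤ 2 * τ k * (g k - m) := fun k =>
    mul_nonneg (mul_pos two_pos (hτ k)).le (hgm k)
  have hconv : ∀ y, (∀ z, H y ≤ H z) → ∃ l, Tendsto (fun k => dist y (x k) ^ 2) atTop (nhds l) :=
    fun y hy => exists_tendsto_of_le_add_summable (fun _ => sq_nonneg _) hc hcsum fun k => by
      linarith [hest y hy k, hprod k]
  have hsum : Summable fun k => τ k * (g k - m) := by
    refine (summable_mul_left_iff (two_ne_zero (α := ℝ))).mp ?_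
    simpa only [mul_assoc] using summable_of_le_sub_add hprod
      (fun k => sq_nonneg (dist y₀ (x k))) hc hcsum (hest y₀ hy₀)
  obtain ⟨φ, hφ, hφg⟩ := extraction_forall_of_frequently fun n : ℕ =>
    frequently_lt_of_summable_mul hτ hτsum hsum (Nat.one_div_pos_of_nat (α := ℝ) (n := n))
  obtain ⟨l₀, hl₀⟩ := hconv y₀ hy₀
  obtain ⟨B, hB⟩ := hl₀.bddAbove_range
  have hmem : ∀ n, x (φ n + 1) ∈ Metric.closedBall y₀ (√B) := fun n => by
    rw [Metric.mem_closedBall']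
    exact Real.le_sqrt_of_sq_le (hB ⟨_, rfl⟩)
  obtain ⟨xs, -, ψ, hψ, hlim⟩ := (isCompact_closedBall y₀ (√B)).tendsto_subseq hmem
  have hxs : ∀ y, H xs ≤ H y := by
    have hle : H xs ≤ m := by
      refine hHlsc.le_of_tendsto_of_le_coe hlim
        (b := fun n => m + 1 / ((ψ n : ℝ) + 1)) ?_ fun n => ?_
      · simpa using (tendsto_one_div_add_atTop_nhds_zero_nat.comp hψ.tendsto_atTop).const_add m
      · rw [Function.comp_apply, hg]
        exact EReal.coe_le_coe_iff.mpr (by linarith [hφg (ψ n)])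
    exact fun y => hle.trans (hmin y)
  obtain ⟨l, hl⟩ := hconv xs hxs
  have hzero : l = 0 := by
    have hsub : Tendsto (fun n => φ (ψ n) + 1) atTop atTop :=
      (tendsto_add_atTop_nat 1).comp (hφ.comp hψ).tendsto_atTop
    refine tendsto_nhds_unique (hl.comp hsub) ?_
    simpa [Function.comp_def] using
      (tendsto_const_nhds.dist hlim : Tendsto _ atTop (nhds (dist xs xs))).pow 2
  refine ⟨xs, hxs, tendsto_iff_dist_tendsto_zero.mpr ?_⟩
  simpa [hzero, dist_comm, Real.sqrt_sq dist_nonneg] using hl.sqrt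
end
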